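/- Assume in addition that k is algebraically closed and that S is an integral domain. Let A be a deformation quantization of A₁ over W(k). Then the center of A is exactly W(k)·1, the image of the structure homomorphism W(k) → A. -/

import Mathlib

universe u

open scoped TensorProduct

/-- A symplectic Poisson structure on a commutative `k`-algebra `S`: a `k`-bilinear,
antisymmetric bracket which is a derivation in each argument, satisfies the Jacobi identity,
and is nondegenerate in the sense that the `S`-linear map `ι : Ω¹_{S/k} → Der_k(S,S)`
determined by `ι(g·df) = g·{f,·}` is bijective. -/
structure SymplecticPoisson (k S : Type u) [CommRing k] [CommRing S] [Algebra k S] where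
  bracket : S → S → S
  add_left : ∀ x y z : S, bracket (x + y) z = bracket x z + bracket y z
  smul_left : ∀ (c : k) (x z : S), bracket (c • x) z = c • bracket x z
  antisymm : ∀ x y : S, bracket x y = - bracket y x
  leibniz : ∀ x y z : S, bracket x (y * z) = bracket x y * z + y * bracket x z
  jacobi : ∀ x y z : S,
    bracket x (bracket y z) + bracket y (bracket z x) + bracket z (bracket x y) = 0
  nondeg : ∃ ι : KaehlerDifferential k S ≃ₗ[S] Derivation k S S,
    ∀ f g x : S, ι (g • KaehlerDifferential.D k S f) x = g * bracket f x

/-- The natural map `A ⊗[S] Aᵐᵒᵖ → End_S(A)`, `a ⊗ b ↦ (x ↦ a·x·b)`. -/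
noncomputable def mulLeftRightMap (S : Type u) (A : Type*) [CommRing S] [Ring A]
    [Algebra S A] : A ⊗[S] Aᵐᵒᵖ →ₗ[S] Module.End S A :=
  TensorProduct.lift <| LinearMap.mk₂ S
    (fun a b => (LinearMap.mulRight S b.unop) ∘ₗ (LinearMap.mulLeft S a))
    (fun a₁ a₂ b => by ext x; simp [add_mul])
    (fun s a b => by ext x; simp [smul_mul_assoc])
    (fun a b₁ b₂ => by ext x; simp [mul_add])
    (fun s a b => by ext x; simp [mul_smul_comm])

/-- `A` is an Azumaya algebra over `S`: a finitely generated faithful projective `S`-module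
such that the natural map `A ⊗[S] Aᵐᵒᵖ → End_S(A)` is bijective. -/
def IsAzumayaOver (S : Type u) (A : Type*) [CommRing S] [Ring A] [Algebra S A] : Prop :=
  Module.Finite S A ∧ Module.Projective S A ∧ FaithfulSMul S A ∧
    Function.Bijective (mulLeftRightMap S A)

section CharacteristicP

variable {p : ℕ} [hpp : Fact p.Prime] {k : Type*} [Field k] [CharP k p]

lemma natCast_choose_pred_prime {B : Type*} [Ring B] [CharP B p] (i : ℕ) (hi : i < p) :
    ((p - 1).choose i : B) = (-1) ^ i := by
  induction i with
  | zero => simp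
  | succ i ih =>
    have h1 : ((p.choose (i + 1) : ℕ) : B) = 0 :=
      (CharP.cast_eq_zero_iff B p _).2 (hpp.out.dvd_choose_self (by omega) hi)
    obtain ⟨q, rfl⟩ : ∃ q, p = q + 1 := ⟨p - 1, by omega⟩
    rw [Nat.choose_succ_succ, Nat.cast_add] at h1
    simp only [Nat.add_sub_cancel] at ih ⊢
    rw [ih (by omega)] at h1
    rw [pow_succ, mul_neg_one]
    exact (neg_eq_of_add_eq_zero_right h1).symm

lemma Commute.sub_pow_pred_char {B : Type*} [Ring B] [CharP B p] (hp : 2 < p) {x y : B}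
    (h : Commute x y) :
    (x - y) ^ (p - 1) = ∑ i ∈ Finset.range p, x ^ i * y ^ (p - 1 - i) := by
  rw [sub_eq_add_neg, h.neg_right.add_pow]
  have hp1 : p - 1 + 1 = p := by omega
  rw [hp1]
  refine Finset.sum_congr rfl fun i hi => ?_
  have hi' := Finset.mem_range.1 hi
  have hev : Even (p - 1) := by
    rcases hpp.out.eq_two_or_odd' with h2 | h2
    · omega
    · exact h2.tsub_odd odd_one
  rw [natCast_choose_pred_prime i hi', neg_pow y, mul_assoc, mul_assoc,
    ← ((Commute.neg_one_left y).pow_left _ |>.pow_right _).eq, ← mul_assoc ((-1) ^ _), ← pow_add,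
    Nat.sub_add_cancel (by omega), hev.neg_one_pow, one_mul]

/-- The commutator with `x` as a linear endomorphism. -/
abbrev commutatorMap (k : Type*) {E : Type*} [CommRing k] [Ring E] [Algebra k E] (x : E) :
    Module.End k E :=
  LinearMap.mulLeft k x - LinearMap.mulRight k x

variable {E : Type*} [Ring E] [Algebra k E] [Nontrivial E]

omit hpp in
variable (k p E) in
lemma charP_moduleEnd : CharP (Module.End k E) p :=
  charP_of_injective_algebraMap (algebraMap k (Module.End k E)).injective p

lemma commutatorMap_pow_char (x : E) :
    commutatorMap k x ^ p = commutatorMap k (x ^ p) := by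
  have := charP_moduleEnd p k E
  rw [commutatorMap, sub_pow_char_of_commute p (LinearMap.commute_mulLeft_right x x),
    LinearMap.pow_mulLeft, LinearMap.pow_mulRight]

lemma commutatorMap_pow_pred_char (hp : 2 < p) (x y : E) :
    (commutatorMap k x ^ (p - 1)) y = ∑ i ∈ Finset.range p, x ^ i * y * x ^ (p - 1 - i) := by
  have := charP_moduleEnd p k E
  rw [commutatorMap, (LinearMap.commute_mulLeft_right (R := k) x x).sub_pow_pred_char hp,
    LinearMap.sum_apply]
  refine Finset.sum_congr rfl fun i _ => ?_
  rw [LinearMap.pow_mulLeft, LinearMap.pow_mulRight]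
  simp [mul_assoc]

open Polynomial in
lemma derivative_linear_pow {E : Type*} [Ring E] (x y : E) (n : ℕ) :
    derivative ((C x + C y * X) ^ n) =
      ∑ i ∈ Finset.range n, (C x + C y * X) ^ i * C y * (C x + C y * X) ^ (n - 1 - i) := by
  induction n with
  | zero => simp
  | succ n ih =>
    rw [pow_succ', derivative_mul, ih, Finset.sum_range_succ']
    simp only [derivative_add, derivative_C, derivative_mul, derivative_X, zero_add, zero_mul,
      mul_one, pow_zero, one_mul, Nat.sub_zero, Nat.add_sub_cancel]
    rw [add_comm, Finset.mul_sum]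
    congr 1
    refine Finset.sum_congr rfl fun i hi => ?_
    have := Finset.mem_range.1 hi
    rw [pow_succ', Nat.sub_sub, Nat.add_comm 1 i]
    simp only [mul_assoc]

open Polynomial in
/-- Jacobson's formula in the case where `y` commutes with all iterated commutators of `x`
with `y`. -/
lemma add_pow_char_of_commute_commutator (hp : 2 < p) (x y : E)
    (h : ∀ j, Commute y ((commutatorMap k x ^ j) y)) :
    (x + y) ^ p = x ^ p + (commutatorMap k x ^ (p - 1)) y + y ^ p := by
  set l : E[X] := C x + C y * X with hl
  have key : derivative (l ^ p) = C ((commutatorMap k x ^ (p - 1)) y) := by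
    rw [hl, derivative_linear_pow, ← hl, ← commutatorMap_pow_pred_char (k := k) hp l (C y)]
    generalize p - 1 = m
    induction m with
    | zero => simp
    | succ m ih =>
      rw [pow_succ', Module.End.mul_apply, ih, pow_succ', Module.End.mul_apply]
      simp only [LinearMap.sub_apply, LinearMap.mulLeft_apply, LinearMap.mulRight_apply, hl,
        add_mul, mul_add, C_sub, C_mul]
      have h1 : C y * X * C ((commutatorMap k x ^ m) y)
          = C ((commutatorMap k x ^ m) y) * (C y * X) := by
        rw [mul_assoc, X_mul_C, ← mul_assoc, ← C_mul, (h m).eq, C_mul, mul_assoc]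
      rw [h1]; abel
  have hcast : ∀ (i : ℕ) (c : E), 0 < i → i < p → c * (i : E) = 0 → c = 0 := by
    intro i c h0 hi hc
    have h1 : ((i : k) : k) ≠ 0 := by
      rw [Ne, CharP.cast_eq_zero_iff k p]
      exact Nat.not_dvd_of_pos_of_lt h0 hi
    have h2 : ((i : k) • c) = 0 := by
      rw [Algebra.smul_def, map_natCast, (Nat.cast_commute i c).eq, hc]
    exact (smul_eq_zero.1 h2).resolve_left h1
  have hdeg : (l ^ p).natDegree < p + 1 := by
    have h1 : l.natDegree ≤ 1 := by
      rw [hl, add_comm]; exact natDegree_linear_le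
    have := natDegree_pow_le_of_le p h1
    omega
  have hco : ∀ i, i + 1 < p → (l ^ p).coeff (i + 1) =
      if i = 0 then (commutatorMap k x ^ (p - 1)) y else 0 := by
    intro i hi
    have h1 := congrArg (fun q => q.coeff i) key
    simp only [coeff_derivative, coeff_C] at h1
    split_ifs with h0
    · subst h0; simpa using h1
    · rw [if_neg h0] at h1
      exact hcast (i + 1) _ (by omega) hi (by exact_mod_cast h1)
  have h0 : (l ^ p).coeff 0 = x ^ p := by
    rw [← constantCoeff_apply, map_pow]; simp [hl]
  have hpc : (l ^ p).coeff p = y ^ p := by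
    have h1 : l.natDegree ≤ 1 := by
      rw [hl, add_comm]; exact natDegree_linear_le
    have := coeff_pow_of_natDegree_le (m := p) h1
    rw [mul_one] at this
    rw [this]; simp [hl]
  have heval : (l ^ p).eval 1 = (x + y) ^ p := by
    have := map_pow (eval₂RingHom' (RingHom.id E) 1 fun a => Commute.one_right a) l p
    simp only [eval₂RingHom'_apply] at this
    change eval 1 (l ^ p) = (eval 1 l) ^ p at this
    rw [this]; simp [hl]
  rw [← heval, eval_eq_sum_range' hdeg]
  simp only [one_pow, mul_one]
  obtain ⟨q, hq⟩ : ∃ q, p = q + 2 := ⟨p - 2, by omega⟩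
  rw [Finset.sum_range_succ, hpc]
  congr 1
  have hp' : Finset.range p = Finset.range (q + 1 + 1) := by rw [hq]
  rw [hp', Finset.sum_range_succ', h0, Finset.sum_range_succ', Finset.sum_eq_zero, zero_add,
    add_comm, hco 0 (by omega), if_pos rfl]
  intro i hi
  have := Finset.mem_range.1 hi
  rw [hco _ (by omega), if_neg (by omega)]

end CharacteristicP

section Derivations

variable {p : ℕ} [hpp : Fact p.Prime] {k : Type*} [Field k] [CharP k p]
  {R : Type*} [CommRing R] [Nontrivial R] [Algebra k R]

omit [Nontrivial R] in
lemma commutatorMap_derivation_pow_mulLeft (D : Derivation k R R) (r : R) (j : ℕ) :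
    (commutatorMap k (D : Module.End k R) ^ j) (LinearMap.mulLeft k r) =
      LinearMap.mulLeft k (((D : Module.End k R) ^ j) r) := by
  induction j with
  | zero => simp
  | succ j ih =>
    rw [pow_succ', Module.End.mul_apply, ih, pow_succ', Module.End.mul_apply]
    ext x
    simp only [LinearMap.sub_apply, LinearMap.mulLeft_apply, LinearMap.mulRight_apply,
      Module.End.mul_apply, Derivation.coeFn_coe, Derivation.leibniz, smul_eq_mul]
    ring

/-- In characteristic `p`, the `p`-th iterate of a derivation is a derivation. -/
noncomputable def Derivation.powChar (p : ℕ) [Fact p.Prime] [CharP k p] (D : Derivation k R R) :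
    Derivation k R R :=
  Derivation.mk' ((D : Module.End k R) ^ p) fun a b => by
    have h := LinearMap.congr_fun (commutatorMap_derivation_pow_mulLeft D a p) b
    rw [commutatorMap_pow_char] at h
    simp only [LinearMap.sub_apply, LinearMap.mulLeft_apply, LinearMap.mulRight_apply,
      Module.End.mul_apply] at h
    rw [smul_eq_mul, smul_eq_mul, mul_comm b, ← h]
    ring

lemma Derivation.powChar_apply (D : Derivation k R R) (a : R) :
    D.powChar p a = ((D : Module.End k R) ^ p) a := rfl

variable (p) in
omit [Nontrivial R] hpp in
lemma Derivation.map_pow_char_mul (D : Derivation k R R) (a b : R) :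
    D (a ^ p * b) = a ^ p * D b := by
  have h : (p : R) = 0 := by
    rw [← _root_.map_natCast (algebraMap k R), CharP.cast_eq_zero, map_zero]
  simp [Derivation.leibniz, Derivation.leibniz_pow, ← Nat.cast_smul_eq_nsmul R, h]

variable (p) in
omit [Nontrivial R] hpp in
lemma Derivation.iterate_pow_char_mul (D : Derivation k R R) (a b : R) (j : ℕ) :
    ((D : Module.End k R) ^ j) (a ^ p * b) = a ^ p * ((D : Module.End k R) ^ j) b := by
  induction j with
  | zero => simp
  | succ j ih =>
    rw [pow_succ', Module.End.mul_apply, ih, Module.End.mul_apply]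
    exact D.map_pow_char_mul p _ _

/-- The `p`-th iterate of a derivation applied to an element with logarithmic derivative `u`. -/
lemma Derivation.iterate_char_of_eq_mul (hp : 2 < p) (D : Derivation k R R) (f u : R)
    (hu : D f = u * f) :
    ((D : Module.End k R) ^ p) f = (((D : Module.End k R) ^ (p - 1)) u + u ^ p) * f := by
  have hcomm : ∀ n : ℕ, ((D : Module.End k R) ^ n) f =
      (((D : Module.End k R) + LinearMap.mulLeft k u) ^ n) 1 * f := by
    intro n
    induction n with
    | zero => simp
    | succ n ih =>
      rw [pow_succ', Module.End.mul_apply, ih, pow_succ', Module.End.mul_apply]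
      simp only [LinearMap.add_apply, Derivation.coeFn_coe, Derivation.leibniz, hu,
        LinearMap.mulLeft_apply, smul_eq_mul]
      ring
  rw [hcomm, add_pow_char_of_commute_commutator (k := k) hp]
  · rw [commutatorMap_derivation_pow_mulLeft, LinearMap.pow_mulLeft]
    have h1 : ((D : Module.End k R) ^ p) 1 = 0 := (D.powChar p).map_one_eq_zero
    simp only [LinearMap.add_apply, h1, LinearMap.mulLeft_apply, mul_one, zero_add]
  · intro j
    rw [commutatorMap_derivation_pow_mulLeft]
    ext x
    simp only [Module.End.mul_apply, LinearMap.mulLeft_apply]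
    ring

lemma Derivation.iterate_pow_pred_mul_of_field {K : Type*} [Field K] [Algebra k K] (hp : 2 < p)
    (D : Derivation k K K) (f : K) :
    ((D : Module.End k K) ^ (p - 1)) (f ^ (p - 1) * D f) =
      f ^ (p - 1) * D.powChar p f - (D f) ^ p := by
  by_cases hf : f = 0
  · subst hf
    simp [show p - 1 ≠ 0 by omega, show p ≠ 0 by omega]
  have hfp : f ^ p = f ^ (p - 1) * f := by
    rw [← pow_succ, Nat.sub_add_cancel (by omega)]
  have hu : D f = (D f / f) * f := by field_simp
  have h1 : f ^ (p - 1) * D f = f ^ p * (D f / f) := by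
    rw [hfp]; field_simp
  rw [h1, D.iterate_pow_char_mul p, D.powChar_apply, D.iterate_char_of_eq_mul hp f _ hu, div_pow,
    hfp]
  have : f ^ p ≠ 0 := pow_ne_zero _ hf
  have h2 : f ^ (p - 1) * ((D f) ^ p / f ^ p) * f = (D f) ^ p := by
    rw [hfp] at this ⊢
    field_simp
  rw [← hfp, add_mul, mul_add, ← mul_assoc, ← mul_assoc, h2, hfp]
  ring

end Derivations

section DerivationsOfDomains

variable {p : ℕ} [hpp : Fact p.Prime] {k : Type*} [Field k] [CharP k p]
  {R : Type*} [CommRing R] [IsDomain R] [Algebra k R]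

omit [CharP k p] hpp in
lemma Derivation.exists_extension_fractionRing (D : Derivation k R R) :
    ∃ D' : Derivation k (FractionRing R) (FractionRing R),
      ∀ r : R, D' (algebraMap R _ r) = algebraMap R _ (D r) := by
  let K := FractionRing R
  have := KaehlerDifferential.isLocalizedModule_map k R K (nonZeroDivisors R)
  let g : Ω[R⁄k] →ₗ[R] K := Algebra.linearMap R K ∘ₗ D.liftKaehlerDifferential
  have hunit : ∀ x : nonZeroDivisors R, IsUnit (algebraMap R (Module.End R K) x) := fun x => by
    rw [Module.End.isUnit_iff]
    have hx : algebraMap R K x ≠ 0 := IsFractionRing.to_map_ne_zero_of_mem_nonZeroDivisors x.2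
    constructor
    · intro a b hab
      simpa [Algebra.smul_def, hx] using hab
    · intro b
      exact ⟨(algebraMap R K x)⁻¹ * b, by simp [Algebra.smul_def, mul_inv_cancel_left₀ hx]⟩
  let G := IsLocalizedModule.lift (nonZeroDivisors R) (KaehlerDifferential.map k k R K) g hunit
  let G' := G.extendScalarsOfIsLocalization (nonZeroDivisors R) K
  refine ⟨G'.compDer (KaehlerDifferential.D k K), fun r => ?_⟩
  change G (KaehlerDifferential.D k K (algebraMap R K r)) = _
  rw [← KaehlerDifferential.map_D k k R K,
    IsLocalizedModule.lift_apply]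
  simp [g]
  rfl

lemma Derivation.iterate_pow_pred_mul (hp : 2 < p)
    (D : Derivation k R R) (f : R) :
    ((D : Module.End k R) ^ (p - 1)) (f ^ (p - 1) * D f) =
      f ^ (p - 1) * D.powChar p f - (D f) ^ p := by
  obtain ⟨D', hD'⟩ := D.exists_extension_fractionRing
  have hit : ∀ (n : ℕ) (r : R), ((D' : Module.End k (FractionRing R)) ^ n) (algebraMap R _ r) =
      algebraMap R _ (((D : Module.End k R) ^ n) r) := by
    intro n r
    induction n with
    | zero => simp
    | succ n ih =>
      rw [pow_succ', Module.End.mul_apply, ih, pow_succ', Module.End.mul_apply]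
      exact hD' _
  apply IsFractionRing.injective R (FractionRing R)
  have h := D'.iterate_pow_pred_mul_of_field hp (algebraMap R _ f)
  rw [hD', D'.powChar_apply, hit, ← map_pow, ← map_mul, hit, ← map_mul, ← map_pow, ← map_sub] at h
  exact h

/-- A Witt vector `(t₀, …, tₙ)` whose ghost differential `∑ tᵢ ^ (p ^ (n - i) - 1) dtᵢ` is killed by
all derivations has all components killed by all derivations. -/
lemma Derivation.eq_zero_of_sum_pow_mul_eq_zero (hp : 2 < p) (n : ℕ) (t : ℕ → R)
    (h : ∀ D : Derivation k R R,
      ∑ i ∈ Finset.range (n + 1), t i ^ (p ^ (n - i) - 1) * D (t i) = 0) :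
    ∀ i ≤ n, ∀ D : Derivation k R R, D (t i) = 0 := by
  have : CharP R p := charP_of_injective_algebraMap (algebraMap k R).injective p
  induction n with
  | zero =>
    intro i hi D
    obtain rfl : i = 0 := by omega
    simpa using h D
  | succ n ih =>
    have hlt : ∀ i ≤ n, ∀ D : Derivation k R R, D (t i) = 0 := by
      refine ih fun D => ?_
      have h1 := congrArg ((D : Module.End k R) ^ (p - 1)) (h D)
      have h2 := h (D.powChar p)
      rw [map_zero, map_sum, Finset.sum_range_succ] at h1
      rw [Finset.sum_range_succ] at h2
      have hlast : ((D : Module.End k R) ^ (p - 1)) (t (n + 1) ^ (p ^ (n + 1 - (n + 1)) - 1) *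
          D (t (n + 1))) = t (n + 1) ^ (p ^ (n + 1 - (n + 1)) - 1) * D.powChar p (t (n + 1)) := by
        simp only [Nat.sub_self, pow_zero, one_mul]
        rw [D.powChar_apply]
        conv_rhs => rw [← Nat.sub_add_cancel (show 1 ≤ p by omega), pow_succ]
        rfl
      rw [hlast, ← h2] at h1
      have h3 := add_right_cancel h1
      have hterm : ∀ i ∈ Finset.range (n + 1),
          ((D : Module.End k R) ^ (p - 1)) (t i ^ (p ^ (n + 1 - i) - 1) * D (t i)) =
            t i ^ (p ^ (n + 1 - i) - 1) * D.powChar p (t i) -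
              (t i ^ (p ^ (n - i) - 1) * D (t i)) ^ p := by
        intro i hi
        have hi' : i ≤ n := by have := Finset.mem_range.1 hi; omega
        have he : p ^ (n + 1 - i) - 1 = (p ^ (n - i) - 1) * p + (p - 1) := by
          have : 1 ≤ p ^ (n - i) := Nat.one_le_pow _ _ (by omega)
          rw [show n + 1 - i = n - i + 1 by omega, pow_succ, Nat.sub_mul, one_mul]
          have : p ≤ p ^ (n - i) * p := Nat.le_mul_of_pos_left _ (by omega)
          omega
        rw [he, pow_add, pow_mul, mul_assoc, D.iterate_pow_char_mul p, D.iterate_pow_pred_mul hp,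
          mul_pow]
        ring
      rw [Finset.sum_congr rfl hterm, Finset.sum_sub_distrib, sub_eq_self, ← sum_pow_char] at h3
      exact pow_eq_zero_iff (by omega) |>.1 h3
    intro i hi D
    rcases Nat.lt_or_ge n i with hin | hin
    · obtain rfl : i = n + 1 := by omega
      have := h D
      rw [Finset.sum_range_succ, Finset.sum_eq_zero fun i hi => by
        rw [hlt i (by have := Finset.mem_range.1 hi; omega) D, mul_zero]] at this
      simpa using this
    · exact hlt i hin D

end DerivationsOfDomains

section DifferentialKernel

lemma Derivation.map_mem_pow {k P : Type*} [CommRing k] [CommRing P] [Algebra k P]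
    (D : Derivation k P P) (I : Ideal P) (m : ℕ) {q : P} (hq : q ∈ I ^ (m + 1)) :
    D q ∈ I ^ m := by
  induction m generalizing q with
  | zero => simp
  | succ m ih =>
    rw [pow_succ] at hq
    refine Submodule.mul_induction_on hq (fun a ha b hb => ?_) fun a b ha hb => ?_
    · rw [Derivation.leibniz, smul_eq_mul, smul_eq_mul]
      refine add_mem (Ideal.mul_mem_right _ _ ha) ?_
      rw [pow_succ']
      exact Ideal.mul_mem_mul hb (ih ha)
    · rw [map_add]; exact add_mem ha hb

lemma Derivation.iterate_mem_pow {k P : Type*} [CommRing k] [CommRing P] [Algebra k P]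
    (D : Derivation k P P) (I : Ideal P) (m j : ℕ) {q : P} (hq : q ∈ I ^ (m + j)) :
    ((D : Module.End k P) ^ j) q ∈ I ^ m := by
  induction j generalizing m with
  | zero => simpa using hq
  | succ j ih =>
    rw [pow_succ', Module.End.mul_apply]
    exact D.map_mem_pow I m (ih (m + 1) (by rwa [Nat.add_right_comm, add_assoc]))

variable {p : ℕ} [hpp : Fact p.Prime] {k : Type*} [Field k] [CharP k p]

/-- The Euler derivation `Xᵢ ∂/∂Xᵢ`. -/
noncomputable def eulerDerivation (k : Type*) [CommRing k] {σ : Type*} (i : σ) :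
    Derivation k (MvPolynomial σ k) (MvPolynomial σ k) :=
  (MvPolynomial.X i : MvPolynomial σ k) • MvPolynomial.pderiv i

lemma coeff_eulerDerivation {k : Type*} [CommRing k] {σ : Type*} (i : σ)
    (q : MvPolynomial σ k) (m : σ →₀ ℕ) :
    (eulerDerivation k i q).coeff m = (m i : k) * q.coeff m := by
  classical
  rw [eulerDerivation, Derivation.smul_apply, smul_eq_mul, MvPolynomial.coeff_X_mul']
  split_ifs with h
  · have h1 : 1 ≤ m i := Nat.one_le_iff_ne_zero.2 (Finsupp.mem_support_iff.1 h)
    rw [MvPolynomial.coeff_pderiv, tsub_add_cancel_of_le (Finsupp.single_le_iff.2 h1),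
      Finsupp.tsub_apply, Finsupp.single_eq_same, mul_comm, Nat.cast_sub h1, Nat.cast_one,
      sub_add_cancel]
  · rw [Finsupp.notMem_support_iff.1 h, Nat.cast_zero, zero_mul]

lemma coeff_eulerDerivation_pow {k : Type*} [CommRing k] {σ : Type*} (i : σ)
    (q : MvPolynomial σ k) (m : σ →₀ ℕ) (j : ℕ) :
    (((eulerDerivation k i : Module.End k (MvPolynomial σ k)) ^ j) q).coeff m =
      (m i : k) ^ j * q.coeff m := by
  induction j with
  | zero => simp
  | succ j ih =>
    rw [pow_succ', Module.End.mul_apply, pow_succ', mul_assoc, ← ih]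
    exact coeff_eulerDerivation i _ m

lemma natCast_pow_pred_eq_one (n : ℕ) (h : (n : k) ≠ 0) : (n : k) ^ (p - 1) = 1 := by
  have := ZMod.pow_card_sub_one_eq_one (p := p) (a := (n : ZMod p)) fun h0 => h <| by
    rw [CharP.cast_eq_zero_iff k p]
    rwa [CharP.cast_eq_zero_iff (ZMod p) p] at h0
  simpa using congrArg (ZMod.castHom dvd_rfl k) this

/-- A polynomial whose Euler derivatives lie in a high power of an ideal is congruent modulo that
ideal to a polynomial whose exponents are divisible by `p`. -/
lemma exists_sub_mem_of_eulerDerivation_mem (hp : 2 ≤ p) {σ : Type*} (I : Ideal (MvPolynomial σ k))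
    (q : MvPolynomial σ k) (T : Finset σ) (e : ℕ)
    (hq : ∀ i ∈ T, eulerDerivation k i q ∈ I ^ (e + T.card * p)) :
    ∃ r : MvPolynomial σ k, (∀ m ∈ r.support, ∀ i ∈ T, p ∣ m i) ∧ q - r ∈ I ^ e := by
  classical
  induction T using Finset.induction_on generalizing e with
  | empty => exact ⟨q, by simp, by simp⟩
  | insert j T hj ih =>
    rw [Finset.card_insert_of_notMem hj] at hq
    have he : e + (T.card + 1) * p = e + p + T.card * p := by ring
    rw [he] at hq
    obtain ⟨r, hr, hqr⟩ := ih (e + p) fun i hi => hq i (Finset.mem_insert_of_mem hi)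
    refine ⟨r - ((eulerDerivation k j : Module.End k (MvPolynomial σ k)) ^ (p - 1)) r, ?_, ?_⟩
    · intro m hm i hi
      rw [MvPolynomial.mem_support_iff, MvPolynomial.coeff_sub, coeff_eulerDerivation_pow] at hm
      rcases Finset.mem_insert.1 hi with rfl | hi
      · by_contra hdvd
        rw [natCast_pow_pred_eq_one] at hm
        · simp at hm
        · rwa [Ne, CharP.cast_eq_zero_iff k p]
      · refine hr m ?_ i hi
        rw [MvPolynomial.mem_support_iff]
        intro h0
        simp [h0] at hm
    · rw [sub_sub_eq_add_sub, add_sub_right_comm]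
      refine add_mem (Ideal.pow_le_pow_right (by omega) hqr) ?_
      have h1 : eulerDerivation k j r ∈ I ^ (e + (p - 2)) := by
        have h2 : eulerDerivation k j (q - r) ∈ I ^ (e + (p - 1)) :=
          Derivation.map_mem_pow _ I _ (by rwa [add_assoc, Nat.sub_add_cancel (by omega)])
        have h3 := hq j (Finset.mem_insert_self _ _)
        have h4 : eulerDerivation k j r = eulerDerivation k j q - eulerDerivation k j (q - r) := by
          rw [map_sub, sub_sub_cancel]
        rw [h4]
        exact sub_mem (Ideal.pow_le_pow_right (by omega) h3)
          (Ideal.pow_le_pow_right (by omega) h2)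
      rw [show p - 1 = p - 2 + 1 by omega, pow_succ, Module.End.mul_apply]
      exact Derivation.iterate_mem_pow _ I _ _ h1

lemma exists_pow_eq_of_forall_dvd [PerfectField k] {σ : Type*} (r : MvPolynomial σ k)
    (hr : ∀ m ∈ r.support, ∀ i : σ, p ∣ m i) : ∃ r₀ : MvPolynomial σ k, r = r₀ ^ p := by
  have : ExpChar k p := ExpChar.prime hpp.out
  have : PerfectRing k p := PerfectField.toPerfectRing p
  have hmon : ∀ m ∈ r.support, ∃ f : MvPolynomial σ k,
      MvPolynomial.monomial m (r.coeff m) = f ^ p := by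
    intro m hm
    obtain ⟨c, hc⟩ := surjective_frobenius k p (r.coeff m)
    have hpm : p • m.mapRange (· / p) (Nat.zero_div p) = m := by
      ext i
      simp [Nat.mul_div_cancel' (hr m hm i)]
    refine ⟨MvPolynomial.monomial (m.mapRange (· / p) (Nat.zero_div p)) c, ?_⟩
    rw [MvPolynomial.monomial_pow, ← hc, frobenius_def, hpm]
  choose! f hf using hmon
  refine ⟨∑ m ∈ r.support, f m, ?_⟩
  rw [sum_pow_char, ← Finset.sum_congr rfl hf, ← MvPolynomial.as_sum]

/-- A derivation `P → P` induces a `k`-linear map `P ⧸ I ^ (m + 1) → P ⧸ I ^ m`. -/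
noncomputable def Derivation.quotientPow {k P : Type*} [CommRing k] [CommRing P] [Algebra k P]
    (D : Derivation k P P) (I : Ideal P) (m : ℕ) : P ⧸ I ^ (m + 1) →ₗ[k] P ⧸ I ^ m :=
  Submodule.mapQ ((I ^ (m + 1)).restrictScalars k) ((I ^ m).restrictScalars k)
    (D : P →ₗ[k] P) fun _ hq => D.map_mem_pow I m hq

lemma Derivation.quotientPow_mk {k P : Type*} [CommRing k] [CommRing P] [Algebra k P]
    (D : Derivation k P P) (I : Ideal P) (m : ℕ) (q : P) :
    D.quotientPow I m (Ideal.Quotient.mk _ q) = Ideal.Quotient.mk _ (D q) := rfl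

/-- Over a perfect field of characteristic `p`, an element of a formally smooth algebra of finite
type whose differential vanishes is a `p`-th power. -/
lemma exists_pow_eq_of_kaehlerDifferential_D_eq_zero [PerfectField k] {S : Type*} [CommRing S]
    [Algebra k S] [Algebra.FiniteType k S] [Algebra.FormallySmooth k S] (s : S)
    (hs : KaehlerDifferential.D k S s = 0) : ∃ t : S, s = t ^ p := by
  obtain ⟨n, g, hg⟩ := Algebra.FiniteType.iff_quotient_mvPolynomial''.1 ‹Algebra.FiniteType k S›
  let P := MvPolynomial (Fin n) k
  let I : Ideal P := RingHom.ker g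
  let M := 1 + n * p
  have hle : I ^ (M + 1) ≤ I := Ideal.pow_le_self (by omega)
  let gbar : (P ⧸ I ^ (M + 1)) →ₐ[k] S := Ideal.Quotient.liftₐ (I ^ (M + 1)) g fun a ha => hle ha
  have hgbar : Function.Surjective gbar := fun x => by
    obtain ⟨q, rfl⟩ := hg x
    exact ⟨Ideal.Quotient.mk _ q, rfl⟩
  have hnil : IsNilpotent (RingHom.ker (gbar : (P ⧸ I ^ (M + 1)) →+* S)) := by
    refine ⟨M + 1, ?_⟩
    have hker : RingHom.ker (gbar : (P ⧸ I ^ (M + 1)) →+* S) =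
        I.map (Ideal.Quotient.mk (I ^ (M + 1))) := by
      ext x
      obtain ⟨q, rfl⟩ := Ideal.Quotient.mk_surjective x
      rw [Ideal.mem_quotient_iff_mem hle]
      rfl
    rw [hker, ← Ideal.map_pow, Ideal.map_quotient_self]
    rfl
  let τ := Algebra.FormallySmooth.liftOfSurjective (AlgHom.id k S) gbar hgbar hnil
  have hτ : ∀ x, gbar (τ x) = x :=
    Algebra.FormallySmooth.liftOfSurjective_apply (AlgHom.id k S) gbar hgbar hnil
  obtain ⟨q, hq⟩ := Ideal.Quotient.mk_surjective (τ s)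
  have hqs : g q = s := by
    rw [← hτ s, ← hq]; rfl
  have hd : ∀ D : Derivation k P P, D q ∈ I ^ M := by
    intro D
    have hMM : I ^ (M + 1) ≤ I ^ M := Ideal.pow_le_pow_right (Nat.le_succ M)
    let φ : S →+* P ⧸ I ^ M := (Ideal.Quotient.factor hMM).comp τ.toRingHom
    let _ : Module S (P ⧸ I ^ M) := Module.compHom _ φ
    have : IsScalarTower k S (P ⧸ I ^ M) := ⟨fun c x y => by
      change φ (c • x) * y = c • (φ x * y)
      have : φ (c • x) = c • φ x := by
        obtain ⟨a, ha⟩ := Ideal.Quotient.mk_surjective (τ x)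
        change Ideal.Quotient.factor hMM (τ (c • x)) = c • Ideal.Quotient.factor hMM (τ x)
        rw [map_smul, ← ha]
        rfl
      rw [this, smul_mul_assoc]⟩
    let D' : Derivation k S (P ⧸ I ^ M) :=
      Derivation.mk' (D.quotientPow I M ∘ₗ τ.toLinearMap) fun a b => by
        change D.quotientPow I M (τ (a * b)) =
          φ a * D.quotientPow I M (τ b) + φ b * D.quotientPow I M (τ a)
        obtain ⟨a', ha⟩ := Ideal.Quotient.mk_surjective (τ a)
        obtain ⟨b', hb⟩ := Ideal.Quotient.mk_surjective (τ b)
        have hφa : φ a = Ideal.Quotient.mk _ a' := by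
          change Ideal.Quotient.factor hMM (τ a) = _
          rw [← ha]; rfl
        have hφb : φ b = Ideal.Quotient.mk _ b' := by
          change Ideal.Quotient.factor hMM (τ b) = _
          rw [← hb]; rfl
        rw [map_mul, hφa, hφb, ← ha, ← hb, ← map_mul, D.quotientPow_mk, D.quotientPow_mk,
          D.quotientPow_mk, D.leibniz, map_add, smul_eq_mul, smul_eq_mul, map_mul, map_mul]
    have h1 : D' s = 0 := by
      rw [← D'.liftKaehlerDifferential_comp_D, hs, map_zero]
    change D.quotientPow I M (τ s) = 0 at h1
    rw [← hq, D.quotientPow_mk] at h1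
    exact Ideal.Quotient.eq_zero_iff_mem.1 h1
  obtain ⟨r, hr, hqr⟩ := exists_sub_mem_of_eulerDerivation_mem hpp.out.two_le I q Finset.univ 1
    fun i _ => by simpa [M] using hd (eulerDerivation k i)
  obtain ⟨r₀, rfl⟩ := exists_pow_eq_of_forall_dvd r fun m hm i => hr m hm i (Finset.mem_univ i)
  refine ⟨g r₀, ?_⟩
  rw [pow_one] at hqr
  have : g (q - r₀ ^ p) = 0 := hqr
  rw [map_sub, sub_eq_zero, hqs, map_pow] at this
  exact this

/-- Over an algebraically closed field of characteristic `p`, an element of a domain of finite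
type which is a `p ^ n`-th power for all `n` is a constant. -/
lemma mem_range_algebraMap_of_forall_exists_pow [IsAlgClosed k] {S : Type*} [CommRing S]
    [IsDomain S] [Algebra k S] [Algebra.FiniteType k S] (s : S)
    (hs : ∀ n, ∃ t : S, s = t ^ p ^ n) : ∃ c : k, s = algebraMap k S c := by
  have : CharP S p := charP_of_injective_algebraMap (algebraMap k S).injective p
  have : ExpChar k p := ExpChar.prime hpp.out
  have : PerfectRing k p := PerfectField.toPerfectRing p
  have : IsNoetherianRing S := Algebra.FiniteType.isNoetherianRing k S
  obtain ⟨m, hm⟩ := Ideal.exists_maximal S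
  let : Field (S ⧸ m) := Ideal.Quotient.field m
  have : Algebra.FiniteType k (S ⧸ m) :=
    Algebra.FiniteType.of_surjective (Ideal.Quotient.mkₐ k m) (Ideal.Quotient.mkₐ_surjective k m)
  have : Module.Finite k (S ⧸ m) := finite_of_finite_type_of_isJacobsonRing k (S ⧸ m)
  obtain ⟨c, hc⟩ := (IsAlgClosed.algebraMap_bijective_of_isIntegral (k := k) (K := S ⧸ m)).2
    (Ideal.Quotient.mk m s)
  have hmem : s - algebraMap k S c ∈ m := by
    rw [← Ideal.Quotient.eq_zero_iff_mem, map_sub, ← hc, sub_eq_zero]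
    rfl
  refine ⟨c, sub_eq_zero.1 ?_⟩
  rw [← Ideal.mem_bot, ← Ideal.iInf_pow_eq_bot_of_isDomain m hm.ne_top, Ideal.mem_iInf]
  intro n
  obtain ⟨t, ht⟩ := hs n
  obtain ⟨d, hd⟩ := (bijective_iterateFrobenius k p n).2 c
  have heq : s - algebraMap k S c = (t - algebraMap k S d) ^ p ^ n := by
    rw [sub_pow_char_pow, ← ht, ← hd, iterateFrobenius_def, map_pow]
  rw [heq] at hmem ⊢
  exact Ideal.pow_le_pow_right (Nat.lt_pow_self hpp.out.one_lt).le
    (Ideal.pow_mem_pow (hm.isPrime.mem_of_pow_mem _ hmem) _)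

end DifferentialKernel

section PthPowersInLifts

variable {A B : Type*} [Ring A] [Ring B]

lemma pow_mul_sub_mul_pow (x b : A) (n : ℕ) :
    x ^ n * b - b * x ^ n = ∑ i ∈ Finset.range n, x ^ i * (x * b - b * x) * x ^ (n - 1 - i) := by
  induction n with
  | zero => simp
  | succ n ih =>
    rw [Finset.sum_range_succ']
    simp only [pow_zero, one_mul, Nat.sub_zero, Nat.add_sub_cancel]
    have h : ∀ i ∈ Finset.range n, x ^ (i + 1) * (x * b - b * x) * x ^ (n - (i + 1)) =
        x * (x ^ i * (x * b - b * x) * x ^ (n - 1 - i)) := by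
      intro i _
      rw [pow_succ', Nat.sub_sub, Nat.add_comm 1 i]
      simp only [mul_assoc]
    rw [Finset.sum_congr rfl h, ← Finset.mul_sum, ← ih, pow_succ']
    noncomm_ring

lemma pow_sub_pow_eq_sum (x y : A) (n : ℕ) :
    x ^ n - y ^ n = ∑ i ∈ Finset.range n, x ^ i * (x - y) * y ^ (n - 1 - i) := by
  induction n with
  | zero => simp
  | succ n ih =>
    rw [Finset.sum_range_succ']
    simp only [pow_zero, one_mul, Nat.sub_zero, Nat.add_sub_cancel]
    have h : ∀ i ∈ Finset.range n, x ^ (i + 1) * (x - y) * y ^ (n - (i + 1)) =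
        x * (x ^ i * (x - y) * y ^ (n - 1 - i)) := by
      intro i _
      rw [pow_succ', Nat.sub_sub, Nat.add_comm 1 i]
      simp only [mul_assoc]
    rw [Finset.sum_congr rfl h, ← Finset.mul_sum, ← ih, pow_succ', pow_succ']
    noncomm_ring

variable {p : ℕ} (π : A →+* B) (hker : ∀ a : A, π a = 0 ↔ ∃ b : A, a = (p : A) * b)

lemma eq_zero_of_natCast_pow_mul_eq_zero (htf : ∀ a : A, (p : A) * a = 0 → a = 0) (n : ℕ) (a : A)
    (h : (p : A) ^ n * a = 0) : a = 0 := by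
  induction n with
  | zero => simpa using h
  | succ n ih =>
    rw [pow_succ', mul_assoc] at h
    exact ih (htf _ h)

include hker

lemma exists_mul_of_map_eq {a b : A} (h : π a = π b) : ∃ c, a - b = (p : A) * c :=
  (hker _).1 (by rw [map_sub, h, sub_self])

lemma map_natCast_mul_eq_zero (a : A) : π ((p : A) * a) = 0 :=
  (hker _).2 ⟨a, rfl⟩

lemma natCast_eq_zero_of_ker : (p : B) = 0 := by
  simpa using map_natCast_mul_eq_zero π hker 1

lemma exists_sum_conj_eq (hp : p.Prime) (hp2 : 2 < p) (x c : A) (hx : ∀ y, Commute (π x) y) :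
    ∃ d, ∑ i ∈ Finset.range p, x ^ i * c * x ^ (p - 1 - i) = (p : A) * d ∧
      π d = π x ^ (p - 1) * π c := by
  obtain ⟨e, he⟩ := exists_mul_of_map_eq π hker (a := x * c) (b := c * x) (by
    rw [map_mul, map_mul, (hx _).eq])
  let f : ℕ → A := fun j => ∑ l ∈ Finset.range j, x ^ l * e * x ^ (j - 1 - l)
  have hf : ∀ j, c * x ^ j = x ^ j * c - (p : A) * f j := by
    intro j
    have h := pow_mul_sub_mul_pow x c j
    rw [he] at h
    have h2 : (p : A) * f j =
        ∑ i ∈ Finset.range j, x ^ i * ((p : A) * e) * x ^ (j - 1 - i) := by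
      rw [Finset.mul_sum]
      refine Finset.sum_congr rfl fun i _ => ?_
      rw [← mul_assoc (x ^ i), ← (Nat.cast_commute p (x ^ i)).eq]
      simp only [mul_assoc]
    rw [h2, ← h]; abel
  have hπf : ∀ j, π (f j) = (j : B) * (π x ^ (j - 1) * π e) := by
    intro j
    simp only [f, map_sum, map_mul, map_pow]
    rw [Finset.sum_congr rfl (g := fun _ => π x ^ (j - 1) * π e), Finset.sum_const,
      Finset.card_range, nsmul_eq_mul]
    intro l hl
    have := Finset.mem_range.1 hl
    rw [mul_assoc, ← ((hx _).pow_left _).eq, ← mul_assoc, ← pow_add]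
    congr 2; omega
  refine ⟨x ^ (p - 1) * c - ∑ i ∈ Finset.range p, x ^ i * f (p - 1 - i), ?_, ?_⟩
  · rw [mul_sub, Finset.mul_sum]
    have h1 : (p : A) * (x ^ (p - 1) * c) = ∑ i ∈ Finset.range p, x ^ (p - 1) * c := by simp
    rw [h1, ← Finset.sum_sub_distrib]
    refine Finset.sum_congr rfl fun i hi => ?_
    have := Finset.mem_range.1 hi
    rw [mul_assoc, hf, mul_sub, ← mul_assoc, ← pow_add, Nat.add_sub_cancel' (by omega),
      ← mul_assoc, ← (Nat.cast_commute p (x ^ i)).eq, mul_assoc]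
  · have h1 : ∀ i ∈ Finset.range p, π (x ^ i * f (p - 1 - i)) =
        ((p - 1 - i : ℕ) : B) * (π x ^ (p - 2) * π e) := by
      intro i hi
      have := Finset.mem_range.1 hi
      rw [map_mul, hπf, map_pow, ← mul_assoc, ← (Nat.cast_commute _ _).eq, mul_assoc,
        ← mul_assoc (π x ^ i), ← pow_add]
      rcases Nat.eq_zero_or_pos (p - 1 - i) with h0 | h0
      · simp [h0]
      · congr 3; omega
    rw [map_sub, map_mul, map_pow, map_sum, Finset.sum_congr rfl h1, ← Finset.sum_mul,
      Finset.sum_range_reflect (fun i => (i : B)) p, ← Nat.cast_sum]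
    have h2 : p ∣ ∑ i ∈ Finset.range p, i := by
      have h3 := Finset.sum_range_id_mul_two p
      have : p ∣ (∑ i ∈ Finset.range p, i) * 2 := ⟨_, h3⟩
      exact (hp.dvd_mul.1 this).resolve_right fun h => by
        have := Nat.le_of_dvd (by norm_num) h; omega
    obtain ⟨m, hm⟩ := h2
    rw [hm, Nat.cast_mul, natCast_eq_zero_of_ker π hker]
    simp

lemma exists_commutator_pow_prime (hp : p.Prime) (hp2 : 2 < p) (x b c : A)
    (hx : ∀ y, Commute (π x) y) (r : ℕ) (h : x * b - b * x = (p : A) ^ r * c) :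
    ∃ c', x ^ p * b - b * x ^ p = (p : A) ^ (r + 1) * c' ∧ π c' = π x ^ (p - 1) * π c := by
  obtain ⟨d, hd, hπd⟩ := exists_sum_conj_eq π hker hp hp2 x c hx
  refine ⟨d, ?_, hπd⟩
  rw [pow_mul_sub_mul_pow, h, pow_succ, mul_assoc, ← hd, Finset.mul_sum]
  refine Finset.sum_congr rfl fun i _ => ?_
  rw [← mul_assoc (x ^ i), ← ((Nat.cast_commute p (x ^ i)).pow_left r).eq]
  simp only [mul_assoc]

lemma exists_commutator_pow_prime_pow (hp : p.Prime) (hp2 : 2 < p) (x b c : A)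
    (hx : ∀ y, Commute (π x) y) (h : x * b - b * x = (p : A) * c) (m : ℕ) :
    ∃ c', x ^ p ^ m * b - b * x ^ p ^ m = (p : A) ^ (m + 1) * c' ∧
      π c' = π x ^ (p ^ m - 1) * π c := by
  induction m with
  | zero => exact ⟨c, by simpa using h, by simp⟩
  | succ m ih =>
    obtain ⟨c₁, h₁, hπ₁⟩ := ih
    obtain ⟨c₂, h₂, hπ₂⟩ := exists_commutator_pow_prime π hker hp hp2 (x ^ p ^ m) b c₁
      (fun y => by rw [map_pow]; exact (hx y).pow_left _) _ h₁
    refine ⟨c₂, by rw [pow_succ p m, pow_mul, h₂], ?_⟩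
    rw [hπ₂, hπ₁, map_pow, ← mul_assoc, ← pow_mul, ← pow_add]
    congr 2
    have h1 : 1 ≤ p ^ m := Nat.one_le_pow _ _ hp.pos
    have h2 : p ^ m ≤ p ^ m * p := Nat.le_mul_of_pos_right _ hp.pos
    rw [pow_succ, Nat.mul_sub, mul_one]
    omega

lemma exists_pow_prime_pow_sub (x y : A) (hx : ∀ z, Commute (π x) z)
    (h : π x = π y) (m : ℕ) : ∃ w, x ^ p ^ m - y ^ p ^ m = (p : A) ^ (m + 1) * w := by
  induction m with
  | zero => simpa using exists_mul_of_map_eq π hker h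
  | succ m ih =>
    obtain ⟨w, hw⟩ := ih
    have hsum : π (∑ i ∈ Finset.range p, (x ^ p ^ m) ^ i * w * (y ^ p ^ m) ^ (p - 1 - i)) = 0 := by
      rw [map_sum, Finset.sum_congr rfl (g := fun _ => (π x ^ p ^ m) ^ (p - 1) * π w),
        Finset.sum_const, Finset.card_range, nsmul_eq_mul, natCast_eq_zero_of_ker π hker, zero_mul]
      intro i hi
      have := Finset.mem_range.1 hi
      simp only [map_mul, map_pow, ← h]
      rw [mul_assoc, ← (((hx (π w)).pow_left (p ^ m)).pow_left (p - 1 - i)).eq, ← mul_assoc,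
        ← pow_add, Nat.add_sub_cancel' (by omega)]
    obtain ⟨v, hv⟩ := (hker _).1 hsum
    refine ⟨v, ?_⟩
    rw [pow_succ p m, pow_mul, pow_mul, pow_sub_pow_eq_sum, hw, pow_succ (p : A) (m + 1), mul_assoc,
      ← hv, Finset.mul_sum]
    refine Finset.sum_congr rfl fun i _ => ?_
    rw [← mul_assoc _ _ w, ← ((Nat.cast_commute p ((x ^ p ^ m) ^ i)).pow_left (m + 1)).eq]
    simp only [mul_assoc]

end PthPowersInLifts

section CentralElements

variable {A B S : Type*} [Ring A] [Ring B] [CommRing S] [Algebra S B]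
  {p : ℕ} (π : A →+* B) (hker : ∀ a : A, π a = 0 ↔ ∃ b : A, a = (p : A) * b)

include hker

/-- If the sum of `pⁱ aᵢ ^ (p ^ (n - i))` over `i < n` agrees with the central element `z`
modulo `p ^ n`, and the `aᵢ` are central modulo `p`, then the remainder is central modulo `p`. -/
lemma map_remainder_mem_center (hp : p.Prime) (hp2 : 2 < p)
    (htf : ∀ a : A, (p : A) * a = 0 → a = 0) (hsurj : Function.Surjective π)
    {z : A} (hz : ∀ b, z * b = b * z) (n : ℕ) (a : ℕ → A) (w : A)
    (ha : ∀ i < n, ∀ y, Commute (π (a i)) y)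
    (hzw : z = ∑ i ∈ Finset.range n, (p : A) ^ i * a i ^ p ^ (n - i) + (p : A) ^ n * w) :
    ∀ y, Commute (π w) y := by
  intro y
  obtain ⟨b, rfl⟩ := hsurj y
  have h1 : ∀ i ∈ Finset.range n, ∃ c, a i ^ p ^ (n - i) * b - b * a i ^ p ^ (n - i) =
      (p : A) ^ (n - i + 1) * c := by
    intro i hi
    have hai := ha i (Finset.mem_range.1 hi)
    obtain ⟨c, hc⟩ := exists_mul_of_map_eq π hker (a := a i * b) (b := b * a i) (by
      rw [map_mul, map_mul, (hai _).eq])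
    obtain ⟨c', hc', -⟩ := exists_commutator_pow_prime_pow π hker hp hp2 (a i) b c hai hc (n - i)
    exact ⟨c', hc'⟩
  choose! c hc using h1
  have h2 : (p : A) ^ n * ((p : A) * ∑ i ∈ Finset.range n, c i + (w * b - b * w)) = 0 := by
    have h3 : (p : A) ^ n * ((p : A) * ∑ i ∈ Finset.range n, c i) =
        ∑ i ∈ Finset.range n, ((p : A) ^ i * a i ^ p ^ (n - i) * b -
          b * ((p : A) ^ i * a i ^ p ^ (n - i))) := by
      rw [← mul_assoc, ← pow_succ, Finset.mul_sum]
      refine Finset.sum_congr rfl fun i hi => ?_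
      have := Finset.mem_range.1 hi
      rw [← mul_assoc b, ← ((Nat.cast_commute p b).pow_left i).eq, mul_assoc, mul_assoc, ← mul_sub,
        hc i hi, ← mul_assoc, ← pow_add]
      congr 2; omega
    have h4 : (p : A) ^ n * (w * b - b * w) = (p : A) ^ n * w * b - b * ((p : A) ^ n * w) := by
      rw [← mul_assoc b, ← ((Nat.cast_commute p b).pow_left n).eq, mul_sub, mul_assoc, mul_assoc]
    rw [mul_add, h3, h4, Finset.sum_sub_distrib, ← Finset.sum_mul, ← Finset.mul_sum,
      sub_add_sub_comm, ← add_mul, ← mul_add, ← hzw, hz, sub_self]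
  have h5 := congrArg π (eq_zero_of_natCast_pow_mul_eq_zero htf n _ h2)
  rw [map_add, map_natCast_mul_eq_zero π hker, zero_add, map_sub, map_mul, map_mul, map_zero,
    sub_eq_zero] at h5
  exact h5

/-- The ghost differential of a Witt expansion of a central element vanishes on all brackets. -/
lemma sum_pow_mul_bracket_eq_zero (hp : p.Prime) (hp2 : 2 < p)
    (htf : ∀ a : A, (p : A) * a = 0 → a = 0) (hsurj : Function.Surjective π)
    (hinj : Function.Injective (algebraMap S B)) (br : S → S → S)
    (hbr : ∀ (a b : A) (s t : S), π a = algebraMap S B s → π b = algebraMap S B t →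
      ∃ c : A, (p : A) * c = a * b - b * a ∧ π c = algebraMap S B (br s t))
    {z : A} (hz : ∀ b, z * b = b * z) (n : ℕ) (a : ℕ → A) (t : ℕ → S)
    (ha : ∀ i ≤ n, π (a i) = algebraMap S B (t i))
    (hza : z = ∑ i ∈ Finset.range (n + 1), (p : A) ^ i * a i ^ p ^ (n - i)) (u : S) :
    ∑ i ∈ Finset.range (n + 1), t i ^ (p ^ (n - i) - 1) * br (t i) u = 0 := by
  obtain ⟨b, hb⟩ := hsurj (algebraMap S B u)
  have h1 : ∀ i ∈ Finset.range (n + 1), ∃ c, a i ^ p ^ (n - i) * b - b * a i ^ p ^ (n - i) =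
      (p : A) ^ (n - i + 1) * c ∧
      π c = algebraMap S B (t i ^ (p ^ (n - i) - 1) * br (t i) u) := by
    intro i hi
    have hai := ha i (Nat.lt_succ_iff.1 (Finset.mem_range.1 hi))
    obtain ⟨c, hc, hπc⟩ := hbr (a i) b (t i) u hai hb
    obtain ⟨c', hc', hπc'⟩ := exists_commutator_pow_prime_pow π hker hp hp2 (a i) b c
      (fun y => by rw [hai]; exact Algebra.commutes _ _) hc.symm (n - i)
    exact ⟨c', hc', by rw [hπc', hai, hπc, map_mul, map_pow]⟩
  choose! c hc hπc using h1
  apply hinj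
  rw [map_sum, ← Finset.sum_congr rfl hπc, ← map_sum, map_zero]
  rw [eq_zero_of_natCast_pow_mul_eq_zero htf (n + 1) (∑ i ∈ Finset.range (n + 1), c i), map_zero]
  have h2 : (p : A) ^ (n + 1) * ∑ i ∈ Finset.range (n + 1), c i =
      ∑ i ∈ Finset.range (n + 1), ((p : A) ^ i * a i ^ p ^ (n - i) * b -
        b * ((p : A) ^ i * a i ^ p ^ (n - i))) := by
    rw [Finset.mul_sum]
    refine Finset.sum_congr rfl fun i hi => ?_
    have := Finset.mem_range.1 hi
    rw [← mul_assoc b, ← ((Nat.cast_commute p b).pow_left i).eq, mul_assoc, mul_assoc, ← mul_sub,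
      hc i hi, ← mul_assoc, ← pow_add]
    congr 2; omega
  rw [h2, Finset.sum_sub_distrib, ← Finset.sum_mul, ← Finset.mul_sum, ← hza, hz, sub_self]

lemma exists_witt_expansion_of_central (hp : p.Prime) (hp2 : 2 < p)
    (htf : ∀ a : A, (p : A) * a = 0 → a = 0) (hsurj : Function.Surjective π)
    (hinj : Function.Injective (algebraMap S B))
    (hcen : Set.range (algebraMap S B) = (Subring.center B : Set B)) (br : S → S → S)
    (hbr : ∀ (a b : A) (s t : S), π a = algebraMap S B s → π b = algebraMap S B t →
      ∃ c : A, (p : A) * c = a * b - b * a ∧ π c = algebraMap S B (br s t))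
    (hroot : ∀ (n : ℕ) (t : ℕ → S),
      (∀ u, ∑ i ∈ Finset.range (n + 1), t i ^ (p ^ (n - i) - 1) * br (t i) u = 0) →
      ∀ i ≤ n, ∃ r, t i = r ^ p)
    {z : A} (hz : ∀ b, z * b = b * z) (n : ℕ) : ∃ (a : ℕ → A) (t : ℕ → S),
      (∀ i ≤ n, π (a i) = algebraMap S B (t i)) ∧
      z = ∑ i ∈ Finset.range (n + 1), (p : A) ^ i * a i ^ p ^ (n - i) := by
  have hlift : ∀ w : A, (∀ y, Commute (π w) y) → ∃ s, π w = algebraMap S B s := by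
    intro w hw
    have : π w ∈ Set.range (algebraMap S B) := by
      rw [hcen]
      exact Subring.mem_center_iff.2 fun y => ((hw y).eq).symm
    obtain ⟨s, hs⟩ := this
    exact ⟨s, hs.symm⟩
  have hscalar : ∀ (w : A) (s : S), π w = algebraMap S B s → ∀ y, Commute (π w) y :=
    fun w s h y => by rw [h]; exact Algebra.commutes _ _
  induction n with
  | zero =>
    obtain ⟨s, hs⟩ := hlift z (map_remainder_mem_center π hker hp hp2 htf hsurj hz 0 0 z
      (by simp) (by simp))
    exact ⟨fun _ => z, fun _ => s, fun _ _ => hs, by simp⟩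
  | succ n ih =>
    obtain ⟨a, t, ha, hza⟩ := ih
    choose! r hr using hroot n t
      (sum_pow_mul_bracket_eq_zero π hker hp hp2 htf hsurj hinj br hbr hz n a t ha hza)
    choose x hx using fun i => hsurj (algebraMap S B (r i))
    have h1 : ∀ i ∈ Finset.range (n + 1), ∃ w, a i ^ p ^ (n - i) - x i ^ p ^ (n + 1 - i) =
        (p : A) ^ (n - i + 1) * w := by
      intro i hi
      have hi' : i ≤ n := Nat.lt_succ_iff.1 (Finset.mem_range.1 hi)
      rw [show n + 1 - i = n - i + 1 by omega, pow_succ' p, pow_mul]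
      refine exists_pow_prime_pow_sub π hker _ _ (hscalar _ _ (ha i hi')) ?_ _
      rw [ha i hi', hr i hi', map_pow, map_pow, hx]
    choose! w hw using h1
    have hzx : z = ∑ i ∈ Finset.range (n + 1), (p : A) ^ i * x i ^ p ^ (n + 1 - i) +
        (p : A) ^ (n + 1) * ∑ i ∈ Finset.range (n + 1), w i := by
      rw [hza, Finset.mul_sum, ← Finset.sum_add_distrib]
      refine Finset.sum_congr rfl fun i hi => ?_
      have hi' := Finset.mem_range.1 hi
      rw [show n + 1 = i + (n - i + 1) by omega, pow_add _ i, mul_assoc, ← hw i hi, ← mul_add]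
      congr 1
      rw [show i + (n - i + 1) = n + 1 by omega]
      abel
    obtain ⟨s, hs⟩ := hlift _ (map_remainder_mem_center π hker hp hp2 htf hsurj hz (n + 1) x _
      (fun i _ => hscalar _ _ (hx i)) hzx)
    refine ⟨fun i => if i = n + 1 then ∑ i ∈ Finset.range (n + 1), w i else x i,
      fun i => if i = n + 1 then s else r i, fun i _ => ?_, ?_⟩
    · dsimp only
      split_ifs
      · exact hs
      · exact hx i
    · rw [Finset.sum_range_succ]
      dsimp only
      rw [if_pos rfl, Nat.sub_self, pow_zero, pow_one]
      refine hzx.trans ?_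
      congr 1
      refine Finset.sum_congr rfl fun i hi => ?_
      have := Finset.mem_range.1 hi
      rw [if_neg (by omega)]

/-- The reduction of a central element is a `p ^ n`-th power for every `n`. -/
lemma exists_map_eq_pow_of_central (hp : p.Prime) (hp2 : 2 < p)
    (htf : ∀ a : A, (p : A) * a = 0 → a = 0) (hsurj : Function.Surjective π)
    (hinj : Function.Injective (algebraMap S B))
    (hcen : Set.range (algebraMap S B) = (Subring.center B : Set B)) (br : S → S → S)
    (hbr : ∀ (a b : A) (s t : S), π a = algebraMap S B s → π b = algebraMap S B t →
      ∃ c : A, (p : A) * c = a * b - b * a ∧ π c = algebraMap S B (br s t))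
    (hroot : ∀ (n : ℕ) (t : ℕ → S),
      (∀ u, ∑ i ∈ Finset.range (n + 1), t i ^ (p ^ (n - i) - 1) * br (t i) u = 0) →
      ∀ i ≤ n, ∃ r, t i = r ^ p)
    {z : A} (hz : ∀ b, z * b = b * z) :
    ∃ s : S, π z = algebraMap S B s ∧ ∀ n, ∃ t, s = t ^ p ^ n := by
  have h : ∀ n, ∃ t : S, π z = algebraMap S B (t ^ p ^ n) := by
    intro n
    obtain ⟨a, t, ha, hza⟩ := exists_witt_expansion_of_central π hker hp hp2 htf hsurj hinj hcen br
      hbr hroot hz n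
    refine ⟨t 0, ?_⟩
    rw [hza, Finset.sum_range_succ', map_add, map_sum, Finset.sum_eq_zero]
    · simp [ha 0 (Nat.zero_le n)]
    · intro i _
      rw [pow_succ', mul_assoc]
      exact map_natCast_mul_eq_zero π hker _
  obtain ⟨s, hs⟩ := h 0
  rw [pow_zero, pow_one] at hs
  refine ⟨s, hs, fun n => ?_⟩
  obtain ⟨t, ht⟩ := h n
  exact ⟨t, hinj (hs ▸ ht)⟩

end CentralElements

/-- An element of a `p`-torsion-free and `p`-adically separated `W(k)`-algebra lies in the image of
`W(k)` if a subset of the algebra containing it is closed under subtracting a scalar and dividing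
by `p`. -/
lemma mem_range_algebraMap_wittVector {p : ℕ} [Fact p.Prime] {k : Type*} [Field k] [CharP k p]
    [PerfectRing k p] {A : Type*} [Ring A] [Algebra (WittVector p k) A]
    (hsep : ∀ a : A, (∀ j : ℕ, ∃ b : A, a = (p : A) ^ j * b) → a = 0) (Z : Set A)
    (hZ : ∀ z ∈ Z, ∃ (w : WittVector p k) (z' : A),
      z' ∈ Z ∧ z = algebraMap (WittVector p k) A w + (p : A) * z')
    {z : A} (hz : z ∈ Z) : z ∈ Set.range (algebraMap (WittVector p k) A) := by
  choose! w q hq hzq using hZ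
  let x : ℕ → A := fun n => q^[n] z
  have hx : ∀ n, x n ∈ Z := fun n => by
    induction n with
    | zero => exact hz
    | succ n ih => simp only [x, Function.iterate_succ_apply']; exact hq _ ih
  let v : ℕ → WittVector p k := fun n => ∑ i ∈ Finset.range n, (p : WittVector p k) ^ i * w (x i)
  have hv : ∀ n, z = algebraMap _ A (v n) + (p : A) ^ n * x n := by
    intro n
    induction n with
    | zero => simp [v, x]
    | succ n ih =>
      have h1 : x (n + 1) = q (x n) := Function.iterate_succ_apply' q n z
      have h2 := hzq (x n) (hx n)
      have h3 : algebraMap _ A (v (n + 1)) =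
          algebraMap _ A (v n) + (p : A) ^ n * algebraMap _ A (w (x n)) := by
        simp [v, Finset.sum_range_succ]
      rw [h3, h1, pow_succ, add_assoc, mul_assoc, ← mul_add, ← h2]
      exact ih
  obtain ⟨l, hl⟩ := IsPrecomplete.prec' (I := Ideal.span {(p : WittVector p k)})
    (M := WittVector p k) v (by
      intro m n hmn
      rw [SModEq.comm, SModEq.sub_mem, smul_eq_mul, Ideal.mul_top, Ideal.span_singleton_pow,
        Ideal.mem_span_singleton]
      have h : v m + ∑ i ∈ Finset.Ico m n, (p : WittVector p k) ^ i * w (x i) = v n :=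
        Finset.sum_range_add_sum_Ico _ hmn
      rw [← h, add_sub_cancel_left]
      exact Finset.dvd_sum fun i hi =>
        Dvd.dvd.mul_right (pow_dvd_pow _ (Finset.mem_Ico.1 hi).1) _)
  refine ⟨l, (sub_eq_zero.1 (hsep _ fun j => ?_)).symm⟩
  have h := hl j
  rw [SModEq.sub_mem, smul_eq_mul, Ideal.mul_top, Ideal.span_singleton_pow,
    Ideal.mem_span_singleton] at h
  obtain ⟨y, hy⟩ := h
  refine ⟨algebraMap _ A y + x j, ?_⟩
  have h2 : algebraMap _ A (v j) - algebraMap _ A l = (p : A) ^ j * algebraMap _ A y := by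
    rw [← map_sub, hy]; simp
  rw [mul_add, ← h2, sub_add_eq_add_sub, ← hv j]

/-- Elements killed by a weighted sum of Hamiltonian derivations of a symplectic Poisson structure
are killed by the same weighted sum of all derivations. -/
lemma SymplecticPoisson.sum_mul_D_eq_zero {k S : Type u} [CommRing k] [CommRing S] [Algebra k S]
    (P : SymplecticPoisson k S) {ι : Type*} (T : Finset ι) (g t : ι → S)
    (h : ∀ u, ∑ i ∈ T, g i * P.bracket (t i) u = 0) :
    ∑ i ∈ T, g i • KaehlerDifferential.D k S (t i) = 0 := by
  obtain ⟨e, he⟩ := P.nondeg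
  apply e.injective
  rw [map_zero, map_sum]
  ext u
  have h1 := congrFun (map_sum (Derivation.coeFnAddMonoidHom : Derivation k S S →+ S → S)
    (fun i => e (g i • KaehlerDifferential.D k S (t i))) T) u
  refine h1.trans ?_
  rw [Finset.sum_apply, Derivation.zero_apply, ← h u]
  exact Finset.sum_congr rfl fun i _ => he _ _ _

lemma SymplecticPoisson.D_eq_zero_of_forall_derivation {k S : Type u} [CommRing k] [CommRing S]
    [Algebra k S] (P : SymplecticPoisson k S) (s : S) (h : ∀ D : Derivation k S S, D s = 0) :
    KaehlerDifferential.D k S s = 0 := by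
  obtain ⟨e, he⟩ := P.nondeg
  apply e.injective
  ext u
  have h1 := he s 1 u
  rw [one_smul, one_mul] at h1
  have h2 := he u 1 s
  rw [h, one_mul] at h2
  rw [h1, P.antisymm, ← h2, neg_zero, map_zero, Derivation.zero_apply]

/-- Let `k` be an algebraically closed field of characteristic `p > 2`, `S` a
smooth affine symplectic `k`-algebra which is a domain, `A₁` an Azumaya algebra over
`S = Z(A₁)`, and `A` a deformation quantization of `A₁` over `W(k)` (a `p`-torsion-free,
`p`-adically separated and complete `W(k)`-algebra with structural surjection `π : A → A₁`
having kernel `pA`). Then the center of `A` is exactly `W(k)·1`, the image of the structure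
homomorphism `W(k) → A`. -/
theorem stmt_5 (p : ℕ) [Fact p.Prime] (hp : 2 < p)
    (k : Type u) [Field k] [IsAlgClosed k] [CharP k p] [ExpChar k p] [PerfectRing k p]
    (S : Type u) [CommRing S] [IsDomain S] [Algebra k S]
    (hfg : Algebra.FiniteType k S) [Algebra.FormallySmooth k S]
    (P : SymplecticPoisson k S)
    (A₁ : Type*) [Ring A₁] [Algebra k A₁] [Algebra S A₁] [IsScalarTower k S A₁]
    (hinj : Function.Injective (algebraMap S A₁))
    (hcen : Set.range (algebraMap S A₁) = (Subring.center A₁ : Set A₁))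
    (hAz : IsAzumayaOver S A₁)
    (A : Type*) [Ring A] [Algebra (WittVector p k) A]
    (htf : ∀ a : A, (p : A) * a = 0 → a = 0)
    (hsep : ∀ a : A, (∀ j : ℕ, ∃ b : A, a = (p : A) ^ j * b) → a = 0)
    (hcomplete : ∀ f : ℕ → A, (∀ j : ℕ, ∃ b : A, f (j + 1) - f j = (p : A) ^ j * b) →
      ∃ a : A, ∀ j : ℕ, ∃ b : A, a - f j = (p : A) ^ j * b)
    (π : A →+* A₁) (hsurj : Function.Surjective π)
    (hker : ∀ a : A, π a = 0 ↔ ∃ b : A, a = (p : A) * b)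
    (hcompat : ∀ w : WittVector p k,
      π (algebraMap (WittVector p k) A w) = algebraMap k A₁ (w.coeff 0))
    (hbr : ∀ (a b : A) (s t : S), π a = algebraMap S A₁ s → π b = algebraMap S A₁ t →
      ∃ c : A, (p : A) * c = a * b - b * a ∧ π c = algebraMap S A₁ (P.bracket s t)) :
    (Subring.center A : Set A) = Set.range (algebraMap (WittVector p k) A) := by
  have hprime : p.Prime := Fact.out
  have hroot : ∀ (n : ℕ) (t : ℕ → S),
      (∀ u, ∑ i ∈ Finset.range (n + 1), t i ^ (p ^ (n - i) - 1) * P.bracket (t i) u = 0) →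
      ∀ i ≤ n, ∃ r, t i = r ^ p := by
    intro n t ht i hi
    refine exists_pow_eq_of_kaehlerDifferential_D_eq_zero (k := k) (t i)
      (P.D_eq_zero_of_forall_derivation _ ?_)
    refine Derivation.eq_zero_of_sum_pow_mul_eq_zero hp n t (fun D => ?_) i hi
    have h := congrArg D.liftKaehlerDifferential (P.sum_mul_D_eq_zero _ _ t ht)
    simpa only [map_sum, map_smul, Derivation.liftKaehlerDifferential_comp_D, smul_eq_mul,
      map_zero] using h
  ext z
  refine ⟨fun hz => ?_, ?_⟩
  · refine mem_range_algebraMap_wittVector hsep (Subring.center A : Set A) (fun z hz => ?_) hz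
    have hz' : ∀ b, z * b = b * z := fun b => (Subring.mem_center_iff.1 hz b).symm
    obtain ⟨s, hs, hpow⟩ := exists_map_eq_pow_of_central π hker hprime hp htf hsurj hinj hcen
      P.bracket hbr hroot hz'
    obtain ⟨c, rfl⟩ := mem_range_algebraMap_of_forall_exists_pow (p := p) (k := k) s hpow
    obtain ⟨z', hzz'⟩ := exists_mul_of_map_eq π hker (a := z)
      (b := algebraMap (WittVector p k) A (WittVector.teichmuller p c)) (by
        rw [hs, hcompat, WittVector.teichmuller_coeff_zero, ← IsScalarTower.algebraMap_apply])
    refine ⟨WittVector.teichmuller p c, z', Subring.mem_center_iff.2 fun b => ?_, ?_⟩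
    · refine sub_eq_zero.1 (htf _ ?_)
      rw [mul_sub, ← mul_assoc, ← mul_assoc, (Nat.cast_commute p b).eq, mul_assoc, ← hzz', mul_sub,
        sub_mul, hz', Algebra.commutes, sub_self]
    · rw [← hzz', add_sub_cancel]
  · rintro ⟨w, rfl⟩
    exact Subring.mem_center_iff.2 fun b => (Algebra.commutes w b).symm
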